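/- (Canonical form of a rectangular matrix over a ring with nilpotent ideal and residue field.) Let R be a commutative ring and I ⊆ R an ideal with Iᵏ = 0 for some k ≥ 1, such that the quotient ring R/I is a field. Let M be an n×m matrix over R. Then there exist an integer r with 0 ≤ r ≤ min(n, m), an invertible n×n matrix P' over R, and an invertible m×m matrix P over R such that P' · M · P has the block form fromBlocks 1 0 0 S, i.e. its upper-left r×r block is the identity, its remaining entries in the first r rows and first r columns are zero, and all entries of the lower-right (n−r)×(m−r) block S lie in I. -/

import Mathlib

open Matrix

/-- A matrix `M` has a pivot form modulo `I` if, up to invertible row and column operations and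
a relabelling of the indices, it is block diagonal with an identity block and a block whose
entries lie in `I`. -/
def HasPivotForm {R α β : Type*} [CommRing R] [Fintype α] [DecidableEq α] [Fintype β]
    [DecidableEq β] (I : Ideal R) (M : Matrix α β R) : Prop :=
  ∃ (r n m : ℕ) (e : Fin r ⊕ Fin n ≃ α) (f : Fin r ⊕ Fin m ≃ β)
    (P : Matrix α α R) (Q : Matrix β β R) (S : Matrix (Fin n) (Fin m) R),
    IsUnit P ∧ IsUnit Q ∧ (∀ i j, S i j ∈ I) ∧
      (P * M * Q).submatrix e f = fromBlocks 1 0 0 S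

namespace HasPivotForm

variable {R α β α' β' : Type*} [CommRing R] {I : Ideal R}
  [Fintype α] [DecidableEq α] [Fintype β] [DecidableEq β]
  [Fintype α'] [DecidableEq α'] [Fintype β'] [DecidableEq β']

theorem of_forall_mem {n m : ℕ} {M : Matrix (Fin n) (Fin m) R} (h : ∀ i j, M i j ∈ I) :
    HasPivotForm I M := by
  refine ⟨0, n, m, Equiv.emptySum _ _, Equiv.emptySum _ _, 1, 1, M,
    isUnit_one, isUnit_one, h, ?_⟩
  ext (i | i) (j | j)
  · exact i.elim0
  · exact i.elim0
  · exact j.elim0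
  · simp

theorem of_mul_mul {M : Matrix α β R} {P : Matrix α α R} {Q : Matrix β β R}
    (hP : IsUnit P) (hQ : IsUnit Q) (h : HasPivotForm I (P * M * Q)) : HasPivotForm I M := by
  obtain ⟨r, n, m, e, f, P₁, Q₁, S, hP₁, hQ₁, hS, h⟩ := h
  refine ⟨r, n, m, e, f, P₁ * P, Q * Q₁, S, hP₁.mul hP, hQ.mul hQ₁, hS, ?_⟩
  simpa only [Matrix.mul_assoc] using h

theorem of_submatrix {M : Matrix α β R} (e : α' ≃ α) (f : β' ≃ β)
    (h : HasPivotForm I (M.submatrix e f)) : HasPivotForm I M := by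
  obtain ⟨r, n, m, e₁, f₁, P, Q, S, hP, hQ, hS, h⟩ := h
  refine ⟨r, n, m, e₁.trans e, f₁.trans f, P.submatrix e.symm e.symm, Q.submatrix f.symm f.symm, S,
    (isUnit_submatrix_equiv _ _).2 hP, (isUnit_submatrix_equiv _ _).2 hQ, hS, ?_⟩
  have hM : M = (M.submatrix e f).submatrix e.symm f.symm := by simp
  rw [hM, submatrix_mul_equiv, submatrix_mul_equiv, ← h]
  ext i j
  simp

theorem fromBlocks_one {T : Matrix α β R} (h : HasPivotForm I T) :
    HasPivotForm I (fromBlocks (1 : Matrix (Fin 1) (Fin 1) R) 0 0 T) := by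
  obtain ⟨r, n, m, e, f, P, Q, S, hP, hQ, hS, h⟩ := h
  refine ⟨1 + r, n, m,
    ((finSumFinEquiv.symm.sumCongr (Equiv.refl _)).trans (Equiv.sumAssoc _ _ _)).trans
      ((Equiv.refl _).sumCongr e),
    ((finSumFinEquiv.symm.sumCongr (Equiv.refl _)).trans (Equiv.sumAssoc _ _ _)).trans
      ((Equiv.refl _).sumCongr f),
    fromBlocks 1 0 0 P, fromBlocks 1 0 0 Q, S, ?_, ?_, hS, ?_⟩
  · exact isUnit_fromBlocks_zero₁₂.2 ⟨isUnit_one, hP⟩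
  · exact isUnit_fromBlocks_zero₁₂.2 ⟨isUnit_one, hQ⟩
  · have h' (i j) : (P * T * Q) (e i) (f j) = fromBlocks 1 0 0 S i j := by
      rw [← h, submatrix_apply]
    simp only [fromBlocks_multiply, Matrix.mul_zero, Matrix.zero_mul, add_zero, zero_add,
      Matrix.mul_one]
    ext (i | i) (j | j)
    · obtain ⟨i, rfl⟩ := finSumFinEquiv.surjective i
      obtain ⟨j, rfl⟩ := finSumFinEquiv.surjective j
      rcases i with i | i <;> rcases j with j | j <;>
        simp [h', -finSumFinEquiv_apply_left, -finSumFinEquiv_apply_right, Matrix.one_apply]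
    · obtain ⟨i, rfl⟩ := finSumFinEquiv.surjective i
      rcases i with i | i <;>
        simp [h', -finSumFinEquiv_apply_left, -finSumFinEquiv_apply_right]
    · obtain ⟨j, rfl⟩ := finSumFinEquiv.surjective j
      rcases j with j | j <;>
        simp [h', -finSumFinEquiv_apply_left, -finSumFinEquiv_apply_right]
    · simp [h']

theorem fromBlocks_of_isUnit {A : Matrix (Fin 1) (Fin 1) R} (hA : IsUnit A)
    (B : Matrix (Fin 1) β R) (C : Matrix α (Fin 1) R) (D : Matrix α β R)
    (h : ∀ T : Matrix α β R, HasPivotForm I T) : HasPivotForm I (fromBlocks A B C D) := by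
  obtain ⟨V, -, hVA⟩ := isUnit_iff_exists.1 hA
  refine of_mul_mul (P := fromBlocks V 0 (-(C * V)) 1) (Q := fromBlocks 1 (-(V * B)) 0 1)
    (isUnit_fromBlocks_zero₁₂.2 ⟨IsUnit.of_mul_eq_one A hVA, isUnit_one⟩)
    (isUnit_fromBlocks_zero₂₁.2 ⟨isUnit_one, isUnit_one⟩) ?_
  convert fromBlocks_one (h (D - C * V * B)) using 1
  simp only [fromBlocks_multiply]
  congr 1 <;> simp [Matrix.mul_assoc, hVA, sub_eq_neg_add]

theorem of_forall_isUnit (hu : ∀ x ∉ I, IsUnit x) :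
    ∀ {n m : ℕ} (M : Matrix (Fin n) (Fin m) R), HasPivotForm I M := by
  intro n
  induction n with
  | zero => exact fun M => of_forall_mem fun i => i.elim0
  | succ n ih =>
    rintro (_ | m) M
    · exact of_forall_mem fun _ j => j.elim0
    by_cases h : ∀ i j, M i j ∈ I
    · exact of_forall_mem h
    push Not at h
    obtain ⟨i, j, hij⟩ := h
    let e (k : ℕ) (a : Fin (k + 1)) : Fin 1 ⊕ Fin k ≃ Fin (k + 1) :=
      (finSumFinEquiv.trans (finCongr (Nat.add_comm 1 k))).trans (Equiv.swap 0 a)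
    have he (k a) : e k a (Sum.inl 0) = a := by
      have h0 : Fin.cast (Nat.add_comm 1 k) (Fin.castAdd k (0 : Fin 1)) = 0 := rfl
      simp [e, h0, -Fin.castAdd_zero]
    refine of_submatrix (e n i) (e m j) ?_
    rw [← fromBlocks_toBlocks (M.submatrix (e n i) (e m j))]
    refine fromBlocks_of_isUnit ?_ _ _ _ ih
    rw [isUnit_iff_isUnit_det, det_fin_one]
    simpa [toBlocks₁₁, he] using hu _ hij

end HasPivotForm

theorem Ideal.isUnit_of_notMem_of_pow_eq_bot {R : Type*} [CommRing R] {I : Ideal R} {k : ℕ}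
    (hI : I ^ k = ⊥) (hfield : IsField (R ⧸ I)) {x : R} (hx : x ∉ I) : IsUnit x := by
  obtain ⟨y, hy⟩ := hfield.mul_inv_cancel (mt Ideal.Quotient.eq_zero_iff_mem.1 hx)
  obtain ⟨y, rfl⟩ := Ideal.Quotient.mk_surjective y
  have hmem : x * y - 1 ∈ I := by
    rw [← Ideal.Quotient.eq_zero_iff_mem, map_sub, map_mul, hy, map_one, sub_self]
  have hnil : IsNilpotent (x * y - 1) := ⟨k, by simpa [hI] using Ideal.pow_mem_pow hmem k⟩
  have hxy := hnil.isUnit_add_one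
  rw [sub_add_cancel] at hxy
  exact isUnit_of_mul_isUnit_left hxy

/-- Canonical form of a rectangular matrix over a commutative ring `R` with a nilpotent
ideal `I` such that `R/I` is a field: there are invertible matrices `P'` and `P` such
that `P' M P` has block form `fromBlocks 1 0 0 S` with the upper-left `r × r` block the
identity and all entries of the lower-right block `S` in `I`. -/
theorem canonical_form_rectangular_matrix
    (R : Type*) [CommRing R]
    (I : Ideal R) (k : ℕ) (hk : 1 ≤ k) (hI : I ^ k = ⊥)
    (hfield : IsField (R ⧸ I))
    (n m : ℕ) (M : Matrix (Fin n) (Fin m) R) :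
    ∃ (r : ℕ) (hr : r ≤ min n m)
      (P' : Matrix (Fin n) (Fin n) R) (P : Matrix (Fin m) (Fin m) R)
      (S : Matrix (Fin (n - r)) (Fin (m - r)) R),
      IsUnit P' ∧ IsUnit P ∧ (∀ i j, S i j ∈ I) ∧
      Matrix.reindex
          ((finCongr (Nat.add_sub_cancel' (hr.trans (min_le_left n m))).symm).trans
            finSumFinEquiv.symm)
          ((finCongr (Nat.add_sub_cancel' (hr.trans (min_le_right n m))).symm).trans
            finSumFinEquiv.symm)
          (P' * M * P)
        = Matrix.fromBlocks 1 0 0 S := by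
  obtain ⟨r, n', m', e, f, P, Q, S, hP, hQ, hS, h⟩ := HasPivotForm.of_forall_isUnit
    (fun _ => Ideal.isUnit_of_notMem_of_pow_eq_bot hI hfield) M
  have hn : r + n' = n := by simpa using Fintype.card_congr e
  have hm : r + m' = m := by simpa using Fintype.card_congr f
  obtain rfl : n' = n - r := by omega
  obtain rfl : m' = m - r := by omega
  have hr : r ≤ min n m := by omega
  refine ⟨r, hr, ?_⟩
  generalize (finCongr (Nat.add_sub_cancel' (hr.trans (min_le_left n m))).symm).trans
    finSumFinEquiv.symm = e₀
  generalize (finCongr (Nat.add_sub_cancel' (hr.trans (min_le_right n m))).symm).trans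
    finSumFinEquiv.symm = f₀
  refine ⟨P.submatrix (e₀.trans e) (Equiv.refl _), Q.submatrix (Equiv.refl _) (f₀.trans f), S,
    (isUnit_submatrix_equiv _ _).2 hP, (isUnit_submatrix_equiv _ _).2 hQ, hS, ?_⟩
  rw [← h]
  ext i j
  simp [Matrix.mul_apply]
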